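/- arXiv:1611.09154 — 2 statements merged into one kernel-verified Lean document; each statement's English description precedes it below -/
import Mathlib

section
/- Theorem 1 (k-Struve kinetic equation): Let d > 0, υ > 0, k > 0, c ∈ ℝ, l > -3k/2, and N_0 ∈ ℝ. Then N(t) = N_0 Σ_{r=0}^∞ [(-c)^r Γ(2r + l/k + 2) / (Γ_k(rk + l + 3k/2) Γ(r + 3/2))] (t/2)^{2r + l/k + 1} E_{υ, 2r + l/k + 2}(−d^υ t^υ) is a solution on (0,∞) of the fractional kinetic equation N(t) − N_0 S^k_{l,c}(t) = −d^υ (I^υ N)(t). -/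
open Real MeasureTheory

/-- The k-Gamma function (via its closed form `Γ_k(x) = k^(x/k-1) Γ(x/k)`). -/
noncomputable def kGamma (k x : ℝ) : ℝ := k ^ (x / k - 1) * Real.Gamma (x / k)

/-- The k-Struve function. -/
noncomputable def kStruve (k ν c x : ℝ) : ℝ :=
  ∑' r : ℕ, (-c) ^ r / (kGamma k ((r : ℝ) * k + ν + 3 * k / 2) * Real.Gamma ((r : ℝ) + 3 / 2)) *
    (x / 2) ^ (2 * (r : ℝ) + ν / k + 1)

/-- The classical Struve function. -/
noncomputable def struveH (p x : ℝ) : ℝ :=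
  ∑' n : ℕ, (-1) ^ n / (Real.Gamma ((n : ℝ) + 3 / 2) * Real.Gamma ((n : ℝ) + p + 3 / 2)) *
    (x / 2) ^ (2 * (n : ℝ) + p + 1)

/-- The Riemann–Liouville fractional integral of order ν. -/
noncomputable def RL (ν : ℝ) (f : ℝ → ℝ) (t : ℝ) : ℝ :=
  (1 / Real.Gamma ν) * ∫ s in (0 : ℝ)..t, (t - s) ^ (ν - 1) * f s

/-- The Laplace transform. -/
noncomputable def laplace (f : ℝ → ℝ) (p : ℝ) : ℝ :=
  ∫ t in Set.Ioi (0 : ℝ), Real.exp (-(p * t)) * f t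

/-- The real two-parameter Mittag-Leffler function. -/
noncomputable def MLE (α β x : ℝ) : ℝ := ∑' n : ℕ, x ^ n / Real.Gamma (α * (n : ℝ) + β)


lemma rl_pow (υ γ t : ℝ) (hυ : 0 < υ) (hγ : 0 < γ) (ht : 0 < t) :
    ∫ s in (0:ℝ)..t, (t - s) ^ (υ - 1) * s ^ (γ - 1) =
      t ^ (υ + γ - 1) * (Real.Gamma γ * Real.Gamma υ / Real.Gamma (γ + υ)) := by
  have h1 := Complex.betaIntegral_scaled (γ : ℂ) (υ : ℂ) ht
  have h2 := Complex.Gamma_mul_Gamma_eq_betaIntegral (s := (γ : ℂ)) (t := (υ : ℂ))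
    (by simpa using hγ) (by simpa using hυ)
  have hG : Real.Gamma (γ + υ) ≠ 0 := (Real.Gamma_pos_of_pos (by positivity)).ne'
  have h3 : Complex.betaIntegral γ υ =
      ((Real.Gamma γ * Real.Gamma υ / Real.Gamma (γ + υ) : ℝ) : ℂ) := by
    rw [← Complex.ofReal_add, Complex.Gamma_ofReal, Complex.Gamma_ofReal, Complex.Gamma_ofReal] at h2
    push_cast
    rw [h2]
    field_simp [Complex.ofReal_ne_zero.2 hG]
  rw [h3] at h1
  apply Complex.ofReal_injective
  rw [← intervalIntegral.integral_ofReal]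
  have h4 : (t : ℂ) ^ ((γ : ℂ) + υ - 1) = ((t ^ (υ + γ - 1) : ℝ) : ℂ) := by
    rw [Complex.ofReal_cpow ht.le]; push_cast; ring_nf
  rw [h4] at h1
  rw [Complex.ofReal_mul, ← h1]
  apply intervalIntegral.integral_congr
  intro s hs
  rw [Set.uIcc_of_le ht.le] at hs
  simp only [Complex.ofReal_mul]
  rw [Complex.ofReal_cpow (by linarith [hs.2]), Complex.ofReal_cpow hs.1]
  push_cast
  ring

lemma rl_int (υ γ t : ℝ) (hυ : 0 < υ) (hγ : 0 < γ) (ht : 0 < t) :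
    IntervalIntegrable (fun s => (t - s) ^ (υ - 1) * s ^ (γ - 1)) volume 0 t := by
  by_contra h
  have h1 := rl_pow υ γ t hυ hγ ht
  rw [intervalIntegral.integral_undef h] at h1
  have := Real.Gamma_pos_of_pos hυ
  have := Real.Gamma_pos_of_pos hγ
  have := Real.Gamma_pos_of_pos (add_pos hγ hυ)
  have : 0 < t ^ (υ + γ - 1) * (Real.Gamma γ * Real.Gamma υ / Real.Gamma (γ + υ)) := by positivity
  linarith

lemma gamma_lower (R x : ℝ) (hR : 0 < R) (hx : 1 ≤ x) :
    R ^ (x - 1) * Real.exp (-R) ≤ Real.Gamma x := by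
  rw [Real.Gamma_eq_integral (by linarith)]
  have hi := Real.GammaIntegral_convergent (s := x) (by linarith)
  calc R ^ (x - 1) * Real.exp (-R) = ∫ u in Set.Ioi R, Real.exp (-u) * R ^ (x - 1) := by
        rw [integral_mul_const, integral_exp_neg_Ioi, mul_comm]
    _ ≤ ∫ u in Set.Ioi R, Real.exp (-u) * u ^ (x - 1) := by
        apply setIntegral_mono_on
        · exact (integrableOn_exp_neg_Ioi R).mul_const _
        · exact hi.mono_set (Set.Ioi_subset_Ioi hR.le)
        · exact measurableSet_Ioi
        · intro u hu
          have hu' : R < u := hu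
          have : R ^ (x - 1) ≤ u ^ (x - 1) := Real.rpow_le_rpow hR.le hu'.le (by linarith)
          gcongr
    _ ≤ _ := by
        apply setIntegral_mono_set hi
        · filter_upwards [ae_restrict_mem measurableSet_Ioi] with u hu
          have hu' : 0 < u := hu
          simp only [Pi.zero_apply]; positivity
        · exact (Set.Ioi_subset_Ioi hR.le).eventuallyLE

lemma ml_summable (υ β y : ℝ) (hυ : 0 < υ) (hy : 0 < y) :
    Summable (fun n : ℕ => y ^ n / Real.Gamma (υ * n + β)) := by
  set R : ℝ := (2 * y) ^ (1 / υ) with hRdef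
  have hR : 0 < R := by positivity
  have hRy : R ^ υ = 2 * y := by
    rw [hRdef, ← Real.rpow_mul (by positivity)]; field_simp; simp
  have hg : Summable (fun n : ℕ => (1/2:ℝ) ^ n * (R ^ (1 - β) * Real.exp R)) :=
    (summable_geometric_of_lt_one (by norm_num) (by norm_num)).mul_right _
  apply Summable.of_norm_bounded_eventually_nat hg
  obtain ⟨M, hM⟩ := exists_nat_gt ((1 - β) / υ)
  filter_upwards [Filter.eventually_ge_atTop M] with n hn
  have hn' : (M : ℝ) ≤ n := by exact_mod_cast hn
  have hx : 1 ≤ υ * n + β := by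
    rw [div_lt_iff₀ hυ] at hM
    nlinarith
  have hl := gamma_lower R _ hR hx
  have hGp := Real.Gamma_pos_of_pos (lt_of_lt_of_le one_pos hx)
  rw [Real.norm_of_nonneg (by positivity), div_le_iff₀ hGp]
  have e : (1/2:ℝ) ^ n * (R ^ (1 - β) * Real.exp R) * (R ^ (υ * n + β - 1) * Real.exp (-R)) = y ^ n := by
    have e1 : R ^ (1 - β) * R ^ (υ * n + β - 1) = (2 * y) ^ n := by
      rw [← Real.rpow_add hR, ← hRy, ← Real.rpow_mul_natCast hR.le]; ring_nf
    have e2 : Real.exp R * Real.exp (-R) = 1 := by rw [← Real.exp_add]; simp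
    calc _ = (1/2:ℝ) ^ n * (R ^ (1 - β) * R ^ (υ * n + β - 1)) * (Real.exp R * Real.exp (-R)) := by ring
      _ = _ := by rw [e1, e2, mul_one, ← mul_pow]; ring_nf
  calc y ^ n = _ := e.symm
    _ ≤ _ := by gcongr

lemma gamma_ratio (b h : ℝ) (hb : 0 < b) (hh : 0 ≤ h) (m : ℕ) :
    Real.Gamma (b + m) / Real.Gamma (h + (b + m)) ≤ Real.Gamma b / Real.Gamma (h + b) := by
  induction m with
  | zero => simp
  | succ m ih =>
    refine le_trans ?_ ih
    have p1 : 0 < b + m := by positivity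
    have p2 : 0 < h + (b + m) := by positivity
    have e1 : b + ((m + 1 : ℕ) : ℝ) = (b + m) + 1 := by push_cast; ring
    rw [e1, ← add_assoc h, Real.Gamma_add_one p1.ne', Real.Gamma_add_one p2.ne', mul_div_mul_comm]
    have := Real.Gamma_pos_of_pos p1
    have := Real.Gamma_pos_of_pos p2
    apply mul_le_of_le_one_left (by positivity)
    rw [div_le_one p2]; linarith

lemma core (υ w p : ℝ) (hυ : 0 < υ) (hw : 0 < w) (hp : -3/2 < p) (a : ℕ → ℝ)
    (ha : ∀ t > (0:ℝ), Summable (fun r : ℕ => |a r| * t ^ (2 * (r:ℝ) + p + 1)))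
    (t : ℝ) (ht : 0 < t) :
    Summable (fun r : ℕ => |a r * Real.Gamma (2 * r + p + 2) * t ^ (2 * (r:ℝ) + p + 1) *
        MLE υ (2 * r + p + 2) (-(w * t ^ υ))|) ∧
    (∑' r : ℕ, a r * Real.Gamma (2 * r + p + 2) * t ^ (2 * (r:ℝ) + p + 1) *
        MLE υ (2 * r + p + 2) (-(w * t ^ υ))) - ∑' r : ℕ, a r * t ^ (2 * (r:ℝ) + p + 1) =
    - w * RL υ (fun s => ∑' r : ℕ, a r * Real.Gamma (2 * r + p + 2) * s ^ (2 * (r:ℝ) + p + 1) *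
        MLE υ (2 * r + p + 2) (-(w * s ^ υ))) t := by
  set β : ℕ → ℝ := fun r => 2 * r + p + 2 with hβ
  have hβp : ∀ r, 0 < β r := fun r => by
    have : (0:ℝ) ≤ r := by positivity
    simp only [hβ]; linarith
  have hγp : ∀ r (n : ℕ), 0 < υ * n + β r := fun r n => by
    have := hβp r; positivity
  have hΓ : ∀ r (n : ℕ), 0 < Real.Gamma (υ * n + β r) := fun r n => Real.Gamma_pos_of_pos (hγp r n)
  -- coefficient
  set C : ℕ × ℕ → ℝ := fun q => a q.1 * Real.Gamma (β q.1) * ((-w) ^ q.2 / Real.Gamma (υ * q.2 + β q.1)) with hC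
  set g : ℝ → ℕ × ℕ → ℝ := fun s q => C q * s ^ (υ * q.2 + β q.1 - 1) with hg
  have hgs : ∀ s > (0:ℝ), Summable (fun q => ‖g s q‖) := by
    intro s hs
    have h1 := ha s hs
    have h2 := (ml_summable υ (β 0) (w * s ^ υ) hυ (by positivity)).mul_left (Real.Gamma (β 0))
    have h3 := h1.mul_of_nonneg h2 (fun r => by positivity) (fun n => by
      have := hΓ 0 n
      have := Real.Gamma_pos_of_pos (hβp 0)
      simp only [Pi.zero_apply]; positivity)
    refine Summable.of_nonneg_of_le (fun q => norm_nonneg _) ?_ h3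
    rintro ⟨r, n⟩
    simp only [hg, hC, norm_mul, norm_div, norm_pow, norm_neg, Real.norm_eq_abs]
    rw [abs_of_pos (hΓ r n), abs_of_pos hw, abs_of_pos (Real.Gamma_pos_of_pos (hβp r)),
      abs_of_pos (Real.rpow_pos_of_pos hs _)]
    have key := gamma_ratio (β 0) (υ * n) (hβp 0) (by positivity) (2 * r)
    have e0 : β 0 + ((2 * r : ℕ) : ℝ) = β r := by simp only [hβ]; push_cast; ring
    rw [e0] at key
    have e1 : s ^ (υ * n + β r - 1) = s ^ (2 * (r:ℝ) + p + 1) * (s ^ υ) ^ n := by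
      rw [← Real.rpow_mul_natCast hs.le, ← Real.rpow_add hs]; simp only [hβ]; ring_nf
    rw [e1, mul_pow]
    calc _ = (|a r| * s ^ (2 * (r:ℝ) + p + 1) * (w ^ n * (s ^ υ) ^ n)) *
            (Real.Gamma (β r) / Real.Gamma (υ * n + β r)) := by ring
      _ ≤ (|a r| * s ^ (2 * (r:ℝ) + p + 1) * (w ^ n * (s ^ υ) ^ n)) *
            (Real.Gamma (β 0) / Real.Gamma (υ * n + β 0)) := by gcongr
      _ = _ := by ring
  have hgs' : ∀ s > (0:ℝ), Summable (g s) := fun s hs => (hgs s hs).of_norm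
  have hterm : ∀ s > (0:ℝ), ∀ r : ℕ, a r * Real.Gamma (2 * r + p + 2) * s ^ (2 * (r:ℝ) + p + 1) *
        MLE υ (2 * r + p + 2) (-(w * s ^ υ)) = ∑' n, g s (r, n) := by
    intro s hs r
    rw [MLE, ← tsum_mul_left]
    congr 1; ext n
    have e1 : s ^ (υ * n + β r - 1) = s ^ (2 * (r:ℝ) + p + 1) * (s ^ υ) ^ n := by
      rw [← Real.rpow_mul_natCast hs.le, ← Real.rpow_add hs]; simp only [hβ]; ring_nf
    simp only [hg, hC]
    rw [e1, ← neg_mul, mul_pow]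
    ring
  have hsum : ∀ s > (0:ℝ), (∑' r : ℕ, a r * Real.Gamma (2 * r + p + 2) * s ^ (2 * (r:ℝ) + p + 1) *
        MLE υ (2 * r + p + 2) (-(w * s ^ υ))) = ∑' q, g s q := by
    intro s hs
    rw [(hgs' s hs).tsum_prod]
    exact tsum_congr (hterm s hs)
  constructor
  · have h := (hgs t ht).prod
    refine Summable.of_nonneg_of_le (fun r => abs_nonneg _) ?_ h
    intro r
    rw [hterm t ht r]
    exact norm_tsum_le_tsum_norm ((hgs t ht).prod_factor r)
  rw [hsum t ht]
  have hΓυ := Real.Gamma_pos_of_pos hυ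
  -- shifted
  have hshift : ∀ q : ℕ × ℕ, -w * (1 / Real.Gamma υ * ∫ s in (0:ℝ)..t, (t - s) ^ (υ - 1) * g s q) =
      g t (q.1, q.2 + 1) := by
    rintro ⟨r, n⟩
    have e : ∀ s, (t - s) ^ (υ - 1) * g s (r, n) =
        C (r, n) * ((t - s) ^ (υ - 1) * s ^ (υ * n + β r - 1)) := fun s => by
      simp only [hg]; ring
    simp only [e, intervalIntegral.integral_const_mul]
    rw [rl_pow υ _ t hυ (hγp r n) ht]
    have e2 : υ * ((n + 1 : ℕ) : ℝ) + β r = υ * n + β r + υ := by push_cast; ring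
    have e3 : υ + (υ * n + β r) - 1 = υ * n + β r + υ - 1 := by ring
    simp only [hg, hC, e2, e3, pow_succ]
    have := (hΓ r n).ne'
    have := (hΓ r (n+1)).ne'
    rw [e2] at this
    field_simp
  have hinj : Function.Injective (fun q : ℕ × ℕ => (q.1, q.2 + 1)) := by
    rintro ⟨r, n⟩ ⟨r', n'⟩ h
    simp only [Prod.mk.injEq, add_left_inj] at h
    exact Prod.ext h.1 h.2
  have hS := (hgs t ht).comp_injective hinj
  have hS' := (hgs' t ht).comp_injective hinj
  have hInt : ∀ q : ℕ × ℕ, IntervalIntegrable (fun s => (t - s) ^ (υ - 1) * g s q) volume 0 t := by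
    intro q
    have e : (fun s => (t - s) ^ (υ - 1) * g s q) = fun s =>
        C q * ((t - s) ^ (υ - 1) * s ^ (υ * q.2 + β q.1 - 1)) := by
      ext s; simp only [hg]; ring
    rw [e]
    exact (rl_int υ _ t hυ (hγp _ _) ht).const_mul _
  have hnorm : ∀ q : ℕ × ℕ, ∫ s in Set.Ioc 0 t, ‖(t - s) ^ (υ - 1) * g s q‖ =
      (Real.Gamma υ / w) * ‖g t (q.1, q.2 + 1)‖ := by
    intro q
    rw [← hshift q]
    have e : ∀ s ∈ Set.Ioc 0 t, ‖(t - s) ^ (υ - 1) * g s q‖ =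
        |C q| * ((t - s) ^ (υ - 1) * s ^ (υ * q.2 + β q.1 - 1)) := fun s hs => by
      have h1 : 0 ≤ (t - s) ^ (υ - 1) := Real.rpow_nonneg (by linarith [hs.2]) _
      have h2 : 0 ≤ s ^ (υ * q.2 + β q.1 - 1) := Real.rpow_nonneg hs.1.le _
      simp only [hg, norm_mul, Real.norm_eq_abs]
      rw [abs_of_nonneg h1, abs_of_nonneg h2]; ring
    have e' : ∀ s, (t - s) ^ (υ - 1) * g s q =
        C q * ((t - s) ^ (υ - 1) * s ^ (υ * q.2 + β q.1 - 1)) := fun s => by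
      simp only [hg]; ring
    rw [setIntegral_congr_fun measurableSet_Ioc e]
    simp only [e', intervalIntegral.integral_const_mul, integral_const_mul]
    rw [← intervalIntegral.integral_of_le ht.le]
    have hpos : 0 ≤ ∫ s in (0:ℝ)..t, (t - s) ^ (υ - 1) * s ^ (υ * q.2 + β q.1 - 1) := by
      rw [rl_pow υ _ t hυ (hγp _ _) ht]
      have := hΓ q.1 q.2
      have := Real.Gamma_pos_of_pos (add_pos (hγp q.1 q.2) hυ)
      positivity
    simp only [norm_mul, norm_neg, norm_div, Real.norm_eq_abs, abs_one]
    rw [abs_of_nonneg hpos, abs_of_pos hw, abs_of_pos hΓυ]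
    field_simp
  have hswap : HasSum (fun q => ∫ s in Set.Ioc 0 t, (t - s) ^ (υ - 1) * g s q)
      (∫ s in Set.Ioc 0 t, ∑' q, (t - s) ^ (υ - 1) * g s q) := by
    apply hasSum_integral_of_summable_integral_norm
    · intro q
      exact (intervalIntegrable_iff_integrableOn_Ioc_of_le ht.le).1 (hInt q)
    · simp only [hnorm]
      exact hS.mul_left _
  have hRL : RL υ (fun s => ∑' r : ℕ, a r * Real.Gamma (2 * r + p + 2) * s ^ (2 * (r:ℝ) + p + 1) *
        MLE υ (2 * r + p + 2) (-(w * s ^ υ))) t =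
      1 / Real.Gamma υ * ∑' q, ∫ s in (0:ℝ)..t, (t - s) ^ (υ - 1) * g s q := by
    rw [RL]
    simp only [intervalIntegral.integral_of_le ht.le]
    rw [hswap.tsum_eq]
    congr 1
    apply setIntegral_congr_fun measurableSet_Ioc
    intro s hs
    simp only
    rw [hsum s hs.1, tsum_mul_left]
  rw [hRL, ← tsum_mul_left, ← tsum_mul_left]
  simp only [hshift]
  rw [(hgs' t ht).tsum_prod, Summable.tsum_prod (f := fun q : ℕ × ℕ => g t (q.1, q.2 + 1)) hS']
  have h0 : ∀ r : ℕ, a r * t ^ (2 * (r:ℝ) + p + 1) = g t (r, 0) := by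
    intro r
    have h1 := (Real.Gamma_pos_of_pos (hβp r)).ne'
    have e : β r - 1 = 2 * (r:ℝ) + p + 1 := by simp only [hβ]; ring
    simp only [hg, hC, pow_zero, Nat.cast_zero, mul_zero, zero_add, e]
    field_simp
  simp only [h0]
  have hz : Summable (fun r : ℕ => g t (r, 0)) := by
    have := ha t ht
    refine Summable.of_norm (this.congr fun r => ?_)
    rw [← h0, norm_mul, Real.norm_eq_abs, Real.norm_of_nonneg (by positivity)]
  rw [← Summable.tsum_sub (hgs' t ht).prod hz]
  congr 1; ext r
  rw [((hgs' t ht).prod_factor r).tsum_eq_zero_add]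
  ring

theorem kStruve_kinetic_solution (d υ k c l N₀ : ℝ) (hd : 0 < d) (hυ : 0 < υ) (hk : 0 < k)
    (hl : -3 * k / 2 < l) :
    ∀ t > (0 : ℝ),
      Summable (fun r : ℕ =>
        |(-c) ^ r * Real.Gamma (2 * (r : ℝ) + l / k + 2) /
            (kGamma k ((r : ℝ) * k + l + 3 * k / 2) * Real.Gamma ((r : ℝ) + 3 / 2)) *
          (t / 2) ^ (2 * (r : ℝ) + l / k + 1) *
          MLE υ (2 * (r : ℝ) + l / k + 2) (-(d ^ υ * t ^ υ))|) ∧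
      (N₀ * ∑' r : ℕ,
          (-c) ^ r * Real.Gamma (2 * (r : ℝ) + l / k + 2) /
              (kGamma k ((r : ℝ) * k + l + 3 * k / 2) * Real.Gamma ((r : ℝ) + 3 / 2)) *
            (t / 2) ^ (2 * (r : ℝ) + l / k + 1) *
            MLE υ (2 * (r : ℝ) + l / k + 2) (-(d ^ υ * t ^ υ))) -
        N₀ * kStruve k l c t =
      -(d ^ υ) * RL υ (fun s =>
          N₀ * ∑' r : ℕ,
            (-c) ^ r * Real.Gamma (2 * (r : ℝ) + l / k + 2) /
                (kGamma k ((r : ℝ) * k + l + 3 * k / 2) * Real.Gamma ((r : ℝ) + 3 / 2)) *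
              (s / 2) ^ (2 * (r : ℝ) + l / k + 1) *
              MLE υ (2 * (r : ℝ) + l / k + 2) (-(d ^ υ * s ^ υ))) t := by
  set p := l / k with hpdef
  have hp : -3/2 < p := by rw [hpdef, lt_div_iff₀ hk]; linarith
  have hw : 0 < d ^ υ := by positivity
  set a : ℕ → ℝ := fun r => (-c) ^ r /
    (kGamma k ((r : ℝ) * k + l + 3 * k / 2) * Real.Gamma ((r : ℝ) + 3 / 2)) *
      (1 / 2) ^ (2 * (r:ℝ) + p + 1) with hadef
  have hkG : ∀ r : ℕ, kGamma k ((r : ℝ) * k + l + 3 * k / 2) =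
      k ^ r * k ^ (p + 1 / 2) * Real.Gamma (1 * r + (p + 3 / 2)) := by
    intro r
    have e : ((r : ℝ) * k + l + 3 * k / 2) / k = 1 * r + (p + 3 / 2) := by
      rw [hpdef]; field_simp; ring
    rw [kGamma, e, ← Real.rpow_natCast, ← Real.rpow_add hk]
    ring_nf
  have ha : ∀ t > (0:ℝ), Summable (fun r : ℕ => |a r| * t ^ (2 * (r:ℝ) + p + 1)) := by
    intro t ht
    set y : ℝ := (|c| + 1) / k * (t / 2) ^ 2 with hy
    have hyp : 0 < y := by positivity
    have hs := (ml_summable 1 (p + 3/2) y one_pos hyp).mul_left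
      (Real.exp 1 * (k ^ (p + 1 / 2))⁻¹ * (t / 2) ^ (p + 1))
    refine Summable.of_nonneg_of_le (fun r => by positivity) ?_ hs
    intro r
    have hG1 : 0 < Real.Gamma (1 * r + (p + 3 / 2)) := Real.Gamma_pos_of_pos (by
      have : (0:ℝ) ≤ r := by positivity
      linarith)
    have hr : (0:ℝ) ≤ r := by positivity
    have hG2 : Real.exp (-1) ≤ Real.Gamma ((r:ℝ) + 3 / 2) := by
      have := gamma_lower 1 ((r:ℝ) + 3/2) one_pos (by linarith)
      simpa using this
    have hG2p : 0 < Real.Gamma ((r:ℝ) + 3 / 2) := lt_of_lt_of_le (Real.exp_pos _) hG2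
    have hG3 : (Real.Gamma ((r:ℝ) + 3 / 2))⁻¹ ≤ Real.exp 1 := by
      rw [Real.exp_neg] at hG2
      exact inv_le_of_inv_le₀ (Real.exp_pos _) hG2
    have e1 : (1 / 2 : ℝ) ^ (2 * (r:ℝ) + p + 1) * t ^ (2 * (r:ℝ) + p + 1) =
        ((t / 2) ^ 2) ^ r * (t / 2) ^ (p + 1) := by
      rw [← Real.mul_rpow (by norm_num) ht.le, ← pow_mul, ← Real.rpow_natCast,
        ← Real.rpow_add (by positivity)]
      push_cast; ring_nf
    simp only [hadef, hkG, abs_mul, abs_div, abs_pow, abs_neg]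
    rw [abs_of_pos hG1, abs_of_pos hG2p, abs_of_pos hk, abs_of_pos (Real.rpow_pos_of_pos hk _),
      abs_of_pos (Real.rpow_pos_of_pos (by norm_num : (0:ℝ) < 1/2) _), mul_assoc _ _ (t ^ _), e1]
    have hc : |c| ^ r ≤ (|c| + 1) ^ r := by gcongr; linarith
    calc _ = |c| ^ r * (Real.Gamma ((r:ℝ) + 3 / 2))⁻¹ * ((k ^ r)⁻¹ * (k ^ (p + 1 / 2))⁻¹ *
          (Real.Gamma (1 * r + (p + 3 / 2)))⁻¹ * (((t / 2) ^ 2) ^ r * (t / 2) ^ (p + 1))) := by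
          field_simp
      _ ≤ (|c| + 1) ^ r * Real.exp 1 * ((k ^ r)⁻¹ * (k ^ (p + 1 / 2))⁻¹ *
          (Real.Gamma (1 * r + (p + 3 / 2)))⁻¹ * (((t / 2) ^ 2) ^ r * (t / 2) ^ (p + 1))) := by
          gcongr
      _ = _ := by
          rw [hy, mul_pow, div_pow (|c| + 1) k r]; field_simp
  have hhalf : ∀ s > (0:ℝ), ∀ r : ℕ, (s / 2) ^ (2 * (r:ℝ) + p + 1) =
      (1 / 2) ^ (2 * (r:ℝ) + p + 1) * s ^ (2 * (r:ℝ) + p + 1) := by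
    intro s hs r
    rw [← Real.mul_rpow (by norm_num) hs.le]; ring_nf
  have hterm : ∀ s > (0:ℝ), ∀ r : ℕ, (-c) ^ r * Real.Gamma (2 * (r : ℝ) + p + 2) /
            (kGamma k ((r : ℝ) * k + l + 3 * k / 2) * Real.Gamma ((r : ℝ) + 3 / 2)) *
          (s / 2) ^ (2 * (r : ℝ) + p + 1) *
          MLE υ (2 * (r : ℝ) + p + 2) (-(d ^ υ * s ^ υ)) =
      a r * Real.Gamma (2 * r + p + 2) * s ^ (2 * (r:ℝ) + p + 1) *
        MLE υ (2 * r + p + 2) (-(d ^ υ * s ^ υ)) := by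
    intro s hs r
    rw [hhalf s hs]; simp only [hadef]; ring
  intro t ht
  obtain ⟨c1, c2⟩ := core υ (d ^ υ) p hυ hw hp a ha t ht
  have hK : kStruve k l c t = ∑' r : ℕ, a r * t ^ (2 * (r:ℝ) + p + 1) := by
    rw [kStruve]
    congr 1; ext r
    rw [← hpdef, hhalf t ht]; simp only [hadef]; ring
  constructor
  · simp only [hterm t ht]; exact c1
  rw [hK]
  simp only [hterm t ht]
  rw [← mul_sub, c2]
  have : ∀ f : ℝ → ℝ, RL υ (fun s => N₀ * f s) t = N₀ * RL υ f t := by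
    intro f
    simp only [RL, mul_left_comm _ N₀, intervalIntegral.integral_const_mul]
  rw [this]
  have hE : RL υ (fun s => ∑' r : ℕ, a r * Real.Gamma (2 * r + p + 2) * s ^ (2 * (r:ℝ) + p + 1) *
        MLE υ (2 * r + p + 2) (-(d ^ υ * s ^ υ))) t =
      RL υ (fun s => ∑' r : ℕ, (-c) ^ r * Real.Gamma (2 * (r : ℝ) + p + 2) /
            (kGamma k ((r : ℝ) * k + l + 3 * k / 2) * Real.Gamma ((r : ℝ) + 3 / 2)) *
          (s / 2) ^ (2 * (r : ℝ) + p + 1) *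
          MLE υ (2 * (r : ℝ) + p + 2) (-(d ^ υ * s ^ υ))) t := by
    simp only [RL, intervalIntegral.integral_of_le ht.le]
    congr 1
    apply setIntegral_congr_fun measurableSet_Ioc
    intro s hs
    simp only [hterm s hs.1]
  rw [hE]
  ring
end

section
/- Corollary (classical case k = 1): Let d > 0, υ > 0, c ∈ ℝ, l > -3/2, N_0 ∈ ℝ. Then N(t) = N_0 Σ_{r=0}^∞ [(-c)^r Γ(2r + l + 2) / (Γ(r + l + 3/2) Γ(r + 3/2))] (t/2)^{2r + l + 1} E_{υ, 2r + l + 2}(−d^υ t^υ) solves N(t) − N_0 S_{l,c}(t) = −d^υ (I^υ N)(t) on (0,∞), where S_{l,c}(t) = Σ_{r=0}^∞ (-c)^r/(Γ(r + l + 3/2) Γ(r + 3/2)) (t/2)^{2r+l+1}. -/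
open Real MeasureTheory

lemma sk_beta (p v t : ℝ) (hp : 0 < p) (hv : 0 < v) (ht : 0 < t) :
    ∫ s in (0:ℝ)..t, (t - s) ^ (v - 1) * s ^ (p - 1) =
      t ^ (p + v - 1) * (Real.Gamma p * Real.Gamma v / Real.Gamma (p + v)) := by
  have h1 := Complex.betaIntegral_scaled (p : ℂ) (v : ℂ) ht
  have h2 := Complex.Gamma_mul_Gamma_eq_betaIntegral (s := (p : ℂ)) (t := (v : ℂ))
    (by simpa using hp) (by simpa using hv)
  have hG : Complex.Gamma ((p : ℂ) + v) ≠ 0 := by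
    rw [← Complex.ofReal_add, Complex.Gamma_ofReal]
    exact_mod_cast (Real.Gamma_pos_of_pos (by positivity)).ne'
  have h3 : Complex.betaIntegral p v = Complex.Gamma p * Complex.Gamma v / Complex.Gamma (p + v) := by
    rw [h2]; field_simp
  rw [h3] at h1
  apply Complex.ofReal_injective
  rw [← intervalIntegral.integral_ofReal]
  have e : ∀ s ∈ Set.uIcc (0:ℝ) t, (((t - s) ^ (v - 1) * s ^ (p - 1) : ℝ) : ℂ) =
      (s : ℂ) ^ ((p : ℂ) - 1) * ((t : ℂ) - s) ^ ((v : ℂ) - 1) := by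
    intro s hs
    rw [Set.uIcc_of_le ht.le] at hs
    rw [Complex.ofReal_mul, Complex.ofReal_cpow (by linarith [hs.2]), Complex.ofReal_cpow hs.1]
    push_cast; ring
  rw [intervalIntegral.integral_congr e, h1]
  rw [Complex.ofReal_mul, Complex.ofReal_cpow ht.le]
  push_cast
  rw [Complex.Gamma_ofReal, Complex.Gamma_ofReal, ← Complex.ofReal_add, Complex.Gamma_ofReal]

lemma sk_beta_int (p v t : ℝ) (hp : 0 < p) (hv : 0 < v) (ht : 0 < t) :
    IntervalIntegrable (fun s => (t - s) ^ (v - 1) * s ^ (p - 1)) volume 0 t := by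
  by_contra h
  have h1 := sk_beta p v t hp hv ht
  rw [intervalIntegral.integral_undef h] at h1
  have : 0 < t ^ (p + v - 1) * (Real.Gamma p * Real.Gamma v / Real.Gamma (p + v)) := by
    have := Real.Gamma_pos_of_pos hp
    have := Real.Gamma_pos_of_pos hv
    have := Real.Gamma_pos_of_pos (add_pos hp hv)
    positivity
  linarith

lemma sk_gamma_lower (R y : ℝ) (hR : 0 < R) (hy : 1 ≤ y) :
    R ^ (y - 1) * Real.exp (-R) ≤ Real.Gamma y := by
  rw [Real.Gamma_eq_integral (by linarith)]
  have hc := Real.GammaIntegral_convergent (s := y) (by linarith)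
  rw [← integral_exp_neg_Ioi R, ← integral_const_mul]
  have hsub : Set.Ioi R ⊆ Set.Ioi (0:ℝ) := Set.Ioi_subset_Ioi hR.le
  calc ∫ x in Set.Ioi R, R ^ (y - 1) * Real.exp (-x)
      ≤ ∫ x in Set.Ioi R, Real.exp (-x) * x ^ (y - 1) := by
        apply setIntegral_mono_on ((integrableOn_exp_neg_Ioi R).const_mul _) (hc.mono_set hsub)
          measurableSet_Ioi
        intro x hx
        rw [mul_comm]
        gcongr
        exact (le_of_lt hx)
    _ ≤ _ := by
        apply setIntegral_mono_set hc
        · filter_upwards [ae_restrict_mem measurableSet_Ioi] with x hx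
          have : (0:ℝ) < x := hx
          simp only [Pi.zero_apply]
          positivity
        · exact Filter.Eventually.of_forall hsub

lemma sk_ml (v b x : ℝ) (hv : 0 < v) (hb : 0 < b) (hx : 0 ≤ x) :
    Summable (fun n : ℕ => x ^ n / Real.Gamma (v * n + b)) := by
  set R : ℝ := (2 * x + 1) ^ (1 / v) with hRdef
  have hR : 0 < R := by positivity
  have hRv : R ^ v = 2 * x + 1 := by
    rw [hRdef, ← Real.rpow_mul (by positivity)]
    rw [one_div_mul_cancel hv.ne', Real.rpow_one]
  obtain ⟨M, hM⟩ := exists_nat_gt (1 / v)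
  have hgeo : Summable (fun n : ℕ => (Real.exp R / R ^ (b - 1)) * (x / (2 * x + 1)) ^ n) := by
    apply Summable.mul_left
    apply summable_geometric_of_lt_one (by positivity)
    rw [div_lt_one (by positivity)]; linarith
  refine (summable_nat_add_iff M).1 (Summable.of_nonneg_of_le ?_ ?_ ((summable_nat_add_iff M).2 hgeo))
  · intro n
    have := Real.Gamma_pos_of_pos (s := v * ((n + M : ℕ) : ℝ) + b) (by positivity)
    positivity
  · intro n
    have hy : 1 ≤ v * ((n + M : ℕ) : ℝ) + b := by
      rw [div_lt_iff₀ hv] at hM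
      push_cast
      have : 0 ≤ v * (n:ℝ) := by positivity
      nlinarith
    have h := sk_gamma_lower R _ hR hy
    have e : R ^ (v * ((n + M : ℕ) : ℝ) + b - 1) * Real.exp (-R) =
        (2 * x + 1) ^ (n + M) * R ^ (b - 1) * (Real.exp R)⁻¹ := by
      rw [add_sub_assoc, Real.rpow_add hR, Real.rpow_mul hR.le, hRv, Real.rpow_natCast, Real.exp_neg]
    rw [e] at h
    calc _ ≤ x ^ (n + M) / ((2 * x + 1) ^ (n + M) * R ^ (b - 1) * (Real.exp R)⁻¹) := by
          gcongr
      _ = _ := by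
          rw [div_pow]
          field_simp

lemma sk_gamma_ratio (a b x : ℝ) (ha : 0 < a) (hab : a ≤ b) (hx : 0 ≤ x) :
    Real.Gamma b / Real.Gamma (x + b) ≤ Real.Gamma a / Real.Gamma (x + a) := by
  have hb : 0 < b := by linarith
  have g1 := Real.Gamma_pos_of_pos ha
  have g2 := Real.Gamma_pos_of_pos hb
  have g3 := Real.Gamma_pos_of_pos (s := x + a) (by linarith)
  have g4 := Real.Gamma_pos_of_pos (s := x + b) (by linarith)
  rcases hx.eq_or_lt with rfl | hx
  · simp [g1.ne', g2.ne']
  have hD : 0 < b - a + x := by linarith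
  have hc := Real.convexOn_log_Gamma
  have k1 := hc.2 (show a ∈ Set.Ioi (0:ℝ) from ha) (show x + b ∈ Set.Ioi (0:ℝ) from add_pos hx hb)
    (show 0 ≤ (b - a) / (b - a + x) from div_nonneg (by linarith) hD.le)
    (show 0 ≤ x / (b - a + x) by positivity) (by field_simp)
  have k2 := hc.2 (show a ∈ Set.Ioi (0:ℝ) from ha) (show x + b ∈ Set.Ioi (0:ℝ) from add_pos hx hb)
    (show 0 ≤ x / (b - a + x) by positivity)
    (show 0 ≤ (b - a) / (b - a + x) from div_nonneg (by linarith) hD.le) (by field_simp; ring)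
  simp only [smul_eq_mul, Function.comp] at k1 k2
  have e1 : (b - a) / (b - a + x) * a + x / (b - a + x) * (x + b) = x + a := by
    field_simp; ring
  have e2 : x / (b - a + x) * a + (b - a) / (b - a + x) * (x + b) = b := by
    field_simp; ring
  rw [e1] at k1
  rw [e2] at k2
  have hs : (b - a) / (b - a + x) = 1 - x / (b - a + x) := by field_simp; ring
  rw [hs] at k1 k2
  have k3 : Real.log (Real.Gamma (x + a)) + Real.log (Real.Gamma b) ≤
      Real.log (Real.Gamma a) + Real.log (Real.Gamma (x + b)) := by linarith
  rw [← Real.log_mul g3.ne' g2.ne', ← Real.log_mul g1.ne' g4.ne',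
    Real.log_le_log_iff (by positivity) (by positivity)] at k3
  rw [div_le_div_iff₀ g4 g3]
  linarith

lemma sk_struve (c l t : ℝ) (hl : -3 / 2 < l) (ht : 0 < t) :
    Summable (fun r : ℕ => |c| ^ r / (Real.Gamma ((r : ℝ) + l + 3 / 2) * Real.Gamma ((r : ℝ) + 3 / 2)) *
            (t / 2) ^ (2 * (r : ℝ) + l + 1)) := by
  have h1 := sk_ml 1 (l + 3 / 2) (|c| * (t / 2) ^ 2) one_pos (by linarith) (by positivity)
  have h2 := sk_ml 1 (3 / 2) 1 one_pos (by norm_num) (by norm_num)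
  have p1 : ∀ r : ℕ, 0 < Real.Gamma ((r : ℝ) + l + 3 / 2) := fun r =>
    Real.Gamma_pos_of_pos (by have : (0:ℝ) ≤ r := r.cast_nonneg
                              linarith)
  have p2 : ∀ r : ℕ, 0 < Real.Gamma ((r : ℝ) + 3 / 2) := fun r =>
    Real.Gamma_pos_of_pos (by positivity)
  have h3 := (h1.mul_of_nonneg h2 (fun r => by
    have := p1 r
    rw [add_assoc] at this
    simp only [one_mul, Pi.zero_apply]
    positivity) (fun r => by
    have := p2 r
    simp only [one_mul, Pi.zero_apply]
    positivity)).comp_injective (i := fun r : ℕ => (r, r)) (fun a b h => by simpa using h)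
  refine (h3.mul_left ((t / 2) ^ (l + 1))).congr fun r => ?_
  have e : (t / 2) ^ (2 * (r : ℝ) + l + 1) = ((t / 2) ^ 2) ^ r * (t / 2) ^ (l + 1) := by
    rw [add_assoc, Real.rpow_add (by positivity), ← pow_mul, ← Real.rpow_natCast]
    push_cast; rfl
  simp only [Function.comp, one_mul, one_pow, e]
  rw [add_assoc (r : ℝ) l, mul_pow]
  simp only [div_eq_mul_inv, mul_inv]
  ring

noncomputable def skF (d v c l : ℝ) (p : ℕ × ℕ) (s : ℝ) : ℝ :=
  (-c) ^ p.1 * Real.Gamma (2 * (p.1 : ℝ) + l + 2) /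
    (Real.Gamma ((p.1 : ℝ) + l + 3 / 2) * Real.Gamma ((p.1 : ℝ) + 3 / 2)) *
      (s / 2) ^ (2 * (p.1 : ℝ) + l + 1) *
      ((-(d ^ v * s ^ v)) ^ p.2 / Real.Gamma (v * (p.2 : ℝ) + (2 * (p.1 : ℝ) + l + 2)))

lemma sk_summable (d v c l s : ℝ) (hd : 0 < d) (hv : 0 < v) (hl : -3 / 2 < l) (hs : 0 < s) :
    Summable (fun p => skF d v c l p s) := by
  have h1 := sk_struve c l s hl hs
  have h2 := (sk_ml v (l + 2) (d ^ v * s ^ v) hv (by linarith) (by positivity)).mul_left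
    (Real.Gamma (l + 2))
  have p0 : 0 < Real.Gamma (l + 2) := Real.Gamma_pos_of_pos (by linarith)
  have p1 : ∀ r : ℕ, 0 < Real.Gamma ((r : ℝ) + l + 3 / 2) := fun r =>
    Real.Gamma_pos_of_pos (by have : (0:ℝ) ≤ r := r.cast_nonneg
                              linarith)
  have p2 : ∀ r : ℕ, 0 < Real.Gamma ((r : ℝ) + 3 / 2) := fun r =>
    Real.Gamma_pos_of_pos (by positivity)
  have p3 : ∀ r : ℕ, 0 < Real.Gamma (2 * (r : ℝ) + l + 2) := fun r =>
    Real.Gamma_pos_of_pos (by have : (0:ℝ) ≤ r := r.cast_nonneg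
                              linarith)
  have p4 : ∀ n : ℕ, 0 < Real.Gamma (v * (n : ℝ) + (l + 2)) := fun n =>
    Real.Gamma_pos_of_pos (by have : (0:ℝ) ≤ v * n := by positivity
                              linarith)
  have p5 : ∀ r n : ℕ, 0 < Real.Gamma (v * (n : ℝ) + (2 * (r : ℝ) + l + 2)) := fun r n =>
    Real.Gamma_pos_of_pos (by have : (0:ℝ) ≤ v * n := by positivity
                              have : (0:ℝ) ≤ r := r.cast_nonneg
                              linarith)
  have h3 := h1.mul_of_nonneg h2 (fun r => by
    have := p1 r
    have := p2 r
    simp only [Pi.zero_apply]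
    positivity) (fun n => by
    have := p4 n
    simp only [Pi.zero_apply]
    positivity)
  refine Summable.of_norm_bounded h3 ?_
  rintro ⟨r, n⟩
  have q1 := p1 r
  have q2 := p2 r
  have q3 := p3 r
  have q5 := p5 r n
  have hr := sk_gamma_ratio (l + 2) (2 * (r : ℝ) + l + 2) (v * n) (by linarith)
    (by have : (0:ℝ) ≤ r := r.cast_nonneg
        linarith) (by positivity)
  have hpos : 0 < (s / 2) ^ (2 * (r : ℝ) + l + 1) := by positivity
  have hpos2 : 0 < d ^ v * s ^ v := by positivity
  simp only [skF, Real.norm_eq_abs, abs_mul, abs_div, abs_pow, abs_neg, abs_of_pos q1,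
    abs_of_pos q2, abs_of_pos q3, abs_of_pos q5, abs_of_pos hpos,
    abs_of_pos (show 0 < d ^ v by positivity), abs_of_pos (show 0 < s ^ v by positivity)]
  calc _ = (|c| ^ r / (Real.Gamma ((r : ℝ) + l + 3 / 2) * Real.Gamma ((r : ℝ) + 3 / 2)) *
            (s / 2) ^ (2 * (r : ℝ) + l + 1)) * (d ^ v * s ^ v) ^ n *
            (Real.Gamma (2 * (r : ℝ) + l + 2) / Real.Gamma (v * (n : ℝ) + (2 * (r : ℝ) + l + 2))) := by
          ring
    _ ≤ (|c| ^ r / (Real.Gamma ((r : ℝ) + l + 3 / 2) * Real.Gamma ((r : ℝ) + 3 / 2)) *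
            (s / 2) ^ (2 * (r : ℝ) + l + 1)) * (d ^ v * s ^ v) ^ n *
            (Real.Gamma (l + 2) / Real.Gamma (v * (n : ℝ) + (l + 2))) := by
          gcongr
    _ = _ := by ring

lemma sk_tsum (d v c l s : ℝ) (r : ℕ) :
    ∑' n, skF d v c l (r, n) s = (-c) ^ r * Real.Gamma (2 * (r : ℝ) + l + 2) /
            (Real.Gamma ((r : ℝ) + l + 3 / 2) * Real.Gamma ((r : ℝ) + 3 / 2)) *
          (s / 2) ^ (2 * (r : ℝ) + l + 1) *
          MLE v (2 * (r : ℝ) + l + 2) (-(d ^ v * s ^ v)) := by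
  simp only [skF, tsum_mul_left, MLE]

lemma sk_pow (d v c l s : ℝ) (hs : 0 < s) (p : ℕ × ℕ) :
    skF d v c l p s = skF d v c l p 1 * s ^ ((v * (p.2 : ℝ) + (2 * (p.1 : ℝ) + l + 2)) - 1) := by
  have e : s ^ ((v * (p.2 : ℝ) + (2 * (p.1 : ℝ) + l + 2)) - 1) =
      (s ^ v) ^ p.2 * s ^ (2 * (p.1 : ℝ) + l + 1) := by
    rw [← Real.rpow_natCast, ← Real.rpow_mul hs.le, ← Real.rpow_add hs]
    congr 1; ring
  have e2 : (s / 2) ^ (2 * (p.1 : ℝ) + l + 1) =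
      (1 / 2) ^ (2 * (p.1 : ℝ) + l + 1) * s ^ (2 * (p.1 : ℝ) + l + 1) := by
    rw [← Real.mul_rpow (by norm_num) hs.le]
    congr 1; ring
  simp only [skF, e, e2, Real.one_rpow, mul_one]
  rw [← neg_mul, mul_pow]
  ring

lemma sk_arg_pos (v l : ℝ) (hv : 0 < v) (hl : -3 / 2 < l) (p : ℕ × ℕ) :
    0 < v * (p.2 : ℝ) + (2 * (p.1 : ℝ) + l + 2) := by
  have : (0:ℝ) ≤ v * p.2 := by positivity
  have : (0:ℝ) ≤ p.1 := p.1.cast_nonneg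
  linarith

lemma sk_step (d v c l t : ℝ) (hd : 0 < d) (hv : 0 < v) (hl : -3 / 2 < l) (ht : 0 < t)
    (p : ℕ × ℕ) :
    skF d v c l p 1 * (t ^ ((v * (p.2 : ℝ) + (2 * (p.1 : ℝ) + l + 2)) + v - 1) *
      (Real.Gamma (v * (p.2 : ℝ) + (2 * (p.1 : ℝ) + l + 2)) * Real.Gamma v /
        Real.Gamma ((v * (p.2 : ℝ) + (2 * (p.1 : ℝ) + l + 2)) + v))) =
      (-(Real.Gamma v / d ^ v)) * skF d v c l (p.1, p.2 + 1) t := by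
  rw [sk_pow d v c l t ht (p.1, p.2 + 1)]
  have g1 := (Real.Gamma_pos_of_pos (sk_arg_pos v l hv hl p)).ne'
  have g2 := (Real.Gamma_pos_of_pos (add_pos (sk_arg_pos v l hv hl p) hv)).ne'
  have hdv : d ^ v ≠ 0 := by positivity
  have e : v * ((p.2 + 1 : ℕ) : ℝ) + (2 * (p.1 : ℝ) + l + 2) =
    v * (p.2 : ℝ) + (2 * (p.1 : ℝ) + l + 2) + v := by push_cast; ring
  simp only [skF, e, Real.one_rpow, mul_one, pow_succ]
  generalize v * (p.2 : ℝ) + (2 * (p.1 : ℝ) + l + 2) = q at *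
  generalize Real.Gamma q = Q at *
  generalize Real.Gamma (q + v) = Q' at *
  generalize d ^ v = D at *
  generalize Real.Gamma (2 * (p.1 : ℝ) + l + 2) = G1
  generalize Real.Gamma ((p.1 : ℝ) + l + 3 / 2) = G2
  generalize Real.Gamma ((p.1 : ℝ) + 3 / 2) = G3
  generalize ((1 : ℝ) / 2) ^ (2 * (p.1 : ℝ) + l + 1) = H
  generalize (-c) ^ p.1 = X
  generalize (-D) ^ p.2 = Y
  simp only [div_eq_mul_inv, mul_inv]
  have i1 : Q⁻¹ * Q = 1 := inv_mul_cancel₀ g1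
  have i2 : D⁻¹ * D = 1 := inv_mul_cancel₀ hdv
  linear_combination (X * G1 * (G2⁻¹ * G3⁻¹) * H * Y * t ^ (q + v - 1) *
    Real.Gamma v * Q'⁻¹) * (i1 - i2)

theorem sk_main (d v c l t : ℝ) (hd : 0 < d) (hv : 0 < v) (hl : -3 / 2 < l) (ht : 0 < t) :
    ∫ s in (0:ℝ)..t, (t - s) ^ (v - 1) * ∑' p, skF d v c l p s =
      -(Real.Gamma v / d ^ v) * ∑' p : ℕ × ℕ, skF d v c l (p.1, p.2 + 1) t := by
  have hinj : Function.Injective (fun p : ℕ × ℕ => (p.1, p.2 + 1)) := by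
    rintro ⟨a, b⟩ ⟨a', b'⟩ h
    simpa using h
  have hS := (sk_summable d v c l t hd hv hl ht).comp_injective hinj
  have hcong : ∀ p, ∀ s ∈ Set.Ioc (0:ℝ) t, (t - s) ^ (v - 1) * skF d v c l p s =
      skF d v c l p 1 * ((t - s) ^ (v - 1) *
        s ^ ((v * (p.2 : ℝ) + (2 * (p.1 : ℝ) + l + 2)) - 1)) := by
    intro p s hs
    rw [sk_pow d v c l s hs.1]; ring
  have hint : ∀ p, IntegrableOn (fun s => (t - s) ^ (v - 1) * skF d v c l p s)
      (Set.Ioc 0 t) volume := by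
    intro p
    rw [integrableOn_congr_fun (hcong p) measurableSet_Ioc]
    exact ((intervalIntegrable_iff_integrableOn_Ioc_of_le ht.le).1
      (sk_beta_int _ v t (sk_arg_pos v l hv hl p) hv ht)).const_mul _
  have hval : ∀ p, ∫ s in Set.Ioc 0 t, (t - s) ^ (v - 1) * skF d v c l p s =
      (-(Real.Gamma v / d ^ v)) * skF d v c l (p.1, p.2 + 1) t := by
    intro p
    rw [setIntegral_congr_fun measurableSet_Ioc (hcong p), integral_const_mul,
      ← intervalIntegral.integral_of_le ht.le, sk_beta _ v t (sk_arg_pos v l hv hl p) hv ht,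
      sk_step d v c l t hd hv hl ht]
  have hnorm : ∀ p, ∫ s in Set.Ioc 0 t, ‖(t - s) ^ (v - 1) * skF d v c l p s‖ =
      |(-(Real.Gamma v / d ^ v)) * skF d v c l (p.1, p.2 + 1) t| := by
    intro p
    have hc2 : ∀ s ∈ Set.Ioc (0:ℝ) t, ‖(t - s) ^ (v - 1) * skF d v c l p s‖ =
      |skF d v c l p 1| * ((t - s) ^ (v - 1) *
        s ^ ((v * (p.2 : ℝ) + (2 * (p.1 : ℝ) + l + 2)) - 1)) := by
      intro s hs
      rw [hcong p s hs, Real.norm_eq_abs, abs_mul]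
      congr 1
      exact abs_of_nonneg (mul_nonneg (Real.rpow_nonneg (by linarith [hs.2]) _)
        (Real.rpow_nonneg hs.1.le _))
    rw [setIntegral_congr_fun measurableSet_Ioc hc2, integral_const_mul,
      ← intervalIntegral.integral_of_le ht.le, sk_beta _ v t (sk_arg_pos v l hv hl p) hv ht,
      ← sk_step d v c l t hd hv hl ht, abs_mul]
    congr 1
    symm
    apply abs_of_nonneg
    have := Real.Gamma_pos_of_pos (sk_arg_pos v l hv hl p)
    have := Real.Gamma_pos_of_pos (add_pos (sk_arg_pos v l hv hl p) hv)
    have := Real.Gamma_pos_of_pos hv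
    positivity
  have key := integral_tsum_of_summable_integral_norm
    (μ := volume.restrict (Set.Ioc 0 t)) hint (by
      simp_rw [hnorm]
      exact (hS.mul_left _).abs)
  rw [intervalIntegral.integral_of_le ht.le]
  simp_rw [← tsum_mul_left]
  rw [← key]
  exact tsum_congr hval

theorem struve_kinetic_solution (d υ c l N₀ : ℝ) (hd : 0 < d) (hυ : 0 < υ)
    (hl : -3 / 2 < l) :
    ∀ t > (0 : ℝ),
      Summable (fun r : ℕ =>
        |(-c) ^ r * Real.Gamma (2 * (r : ℝ) + l + 2) /
            (Real.Gamma ((r : ℝ) + l + 3 / 2) * Real.Gamma ((r : ℝ) + 3 / 2)) *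
          (t / 2) ^ (2 * (r : ℝ) + l + 1) *
          MLE υ (2 * (r : ℝ) + l + 2) (-(d ^ υ * t ^ υ))|) ∧
      (N₀ * ∑' r : ℕ,
          (-c) ^ r * Real.Gamma (2 * (r : ℝ) + l + 2) /
              (Real.Gamma ((r : ℝ) + l + 3 / 2) * Real.Gamma ((r : ℝ) + 3 / 2)) *
            (t / 2) ^ (2 * (r : ℝ) + l + 1) *
            MLE υ (2 * (r : ℝ) + l + 2) (-(d ^ υ * t ^ υ))) -
        N₀ * (∑' r : ℕ,
          (-c) ^ r / (Real.Gamma ((r : ℝ) + l + 3 / 2) * Real.Gamma ((r : ℝ) + 3 / 2)) *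
            (t / 2) ^ (2 * (r : ℝ) + l + 1)) =
      -(d ^ υ) * RL υ (fun s =>
          N₀ * ∑' r : ℕ,
            (-c) ^ r * Real.Gamma (2 * (r : ℝ) + l + 2) /
                (Real.Gamma ((r : ℝ) + l + 3 / 2) * Real.Gamma ((r : ℝ) + 3 / 2)) *
              (s / 2) ^ (2 * (r : ℝ) + l + 1) *
              MLE υ (2 * (r : ℝ) + l + 2) (-(d ^ υ * s ^ υ))) t := by
  intro t ht
  have hS := sk_summable d υ c l t hd hυ hl ht
  have hinj : Function.Injective (fun p : ℕ × ℕ => (p.1, p.2 + 1)) := by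
    rintro ⟨a, b⟩ ⟨a', b'⟩ h
    simpa using h
  have hS' := hS.comp_injective hinj
  simp_rw [← sk_tsum]
  refine ⟨hS.prod.abs, ?_⟩
  have hRL : RL υ (fun s => N₀ * ∑' r : ℕ, ∑' n : ℕ, skF d υ c l (r, n) s) t =
      (1 / Real.Gamma υ) * (N₀ * (-(Real.Gamma υ / d ^ υ) *
        ∑' p : ℕ × ℕ, skF d υ c l (p.1, p.2 + 1) t)) := by
    rw [← sk_main d υ c l t hd hυ hl ht, RL]
    congr 1
    rw [← intervalIntegral.integral_const_mul]
    rw [intervalIntegral.integral_of_le ht.le, intervalIntegral.integral_of_le ht.le]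
    apply setIntegral_congr_fun measurableSet_Ioc
    intro s hs
    have := (sk_summable d υ c l s hd hυ hl hs.1).tsum_prod
    simp only [this]
    ring
  rw [hRL]
  have hG := (Real.Gamma_pos_of_pos hυ).ne'
  have hdv : d ^ υ ≠ 0 := by positivity
  have e1 : ∑' p : ℕ × ℕ, skF d υ c l (p.1, p.2 + 1) t =
      ∑' r : ℕ, ∑' n : ℕ, skF d υ c l (r, n + 1) t := hS'.tsum_prod
  have e2 : ∀ r : ℕ, skF d υ c l (r, 0) t = (-c) ^ r /
      (Real.Gamma ((r : ℝ) + l + 3 / 2) * Real.Gamma ((r : ℝ) + 3 / 2)) *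
            (t / 2) ^ (2 * (r : ℝ) + l + 1) := by
    intro r
    have g := (Real.Gamma_pos_of_pos (sk_arg_pos υ l hυ hl (r, 0))).ne'
    simp only [Nat.cast_zero, mul_zero, zero_add] at g
    simp only [skF, Nat.cast_zero, mul_zero, zero_add, pow_zero]
    generalize Real.Gamma (2 * (r : ℝ) + l + 2) = Q at *
    have : Q * Q⁻¹ = 1 := mul_inv_cancel₀ g
    simp only [div_eq_mul_inv]
    linear_combination ((-c) ^ r *
      (Real.Gamma ((r : ℝ) + l + 3 * 2⁻¹) * Real.Gamma ((r : ℝ) + 3 * 2⁻¹))⁻¹ *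
            (t * 2⁻¹) ^ (2 * (r : ℝ) + l + 1)) * this
  have e3 : ∀ r : ℕ, ∑' n : ℕ, skF d υ c l (r, n) t =
      skF d υ c l (r, 0) t + ∑' n : ℕ, skF d υ c l (r, n + 1) t :=
    fun r => (hS.prod_factor r).tsum_eq_zero_add
  have hz : Summable (fun r : ℕ => skF d υ c l (r, 0) t) :=
    hS.comp_injective (i := fun r : ℕ => (r, 0)) (fun a b h => by simpa using h)
  have e4 : ∑' r : ℕ, ∑' n : ℕ, skF d υ c l (r, n) t =
      ∑' r : ℕ, skF d υ c l (r, 0) t + ∑' r : ℕ, ∑' n : ℕ, skF d υ c l (r, n + 1) t := by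
    simp_rw [e3]
    exact hz.tsum_add hS'.prod
  rw [e1, e4]
  simp_rw [← e2]
  field_simp
  ring
end
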